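/- arXiv:2205.13526 — 2 statements merged into one kernel-verified Lean document; each statement's English description precedes it below -/
import Mathlib

section
/- Let θ¹, θ⁰ : ℝ² → ℝ be smooth solutions of the (1+1)-dimensional linear heat equation ∂_{z₁}θ = ∂²_{z₂}θ on ℝ². Then the function u(t,x,y) := x·θ¹(t³/3, y − tx) − t²·∂_{z₂}θ¹(t³/3, y − tx) + θ⁰(t³/3, y − tx) is a solution of the remarkable Fokker–Planck equation u_t + x u_y = u_xx on all of ℝ³. -/
/-- ∂_t u -/
noncomputable def dT (u : ℝ → ℝ → ℝ → ℝ) (t x y : ℝ) : ℝ := deriv (fun s => u s x y) t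
/-- ∂_y u -/
noncomputable def dY (u : ℝ → ℝ → ℝ → ℝ) (t x y : ℝ) : ℝ := deriv (fun s => u t x s) y
/-- ∂²_x u -/
noncomputable def dXX (u : ℝ → ℝ → ℝ → ℝ) (t x y : ℝ) : ℝ := deriv (deriv (fun s => u t s y)) x

/-- ∂_{z₁} θ -/
noncomputable def d1 (θ : ℝ → ℝ → ℝ) (z1 z2 : ℝ) : ℝ := deriv (fun s => θ s z2) z1
/-- ∂_{z₂} θ -/
noncomputable def d2 (θ : ℝ → ℝ → ℝ) (z1 z2 : ℝ) : ℝ := deriv (fun s => θ z1 s) z2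
/-- ∂²_{z₂} θ -/
noncomputable def d22 (θ : ℝ → ℝ → ℝ) (z1 z2 : ℝ) : ℝ := deriv (deriv (fun s => θ z1 s)) z2

/-- The solution family from the generalized reduction with respect to ((𝔓¹)²u)∂_u. -/
noncomputable def sol13 (θ1 θ0 : ℝ → ℝ → ℝ) (t x y : ℝ) : ℝ :=
  x * θ1 (t ^ 3 / 3) (y - t * x) - t ^ 2 * d2 θ1 (t ^ 3 / 3) (y - t * x)
    + θ0 (t ^ 3 / 3) (y - t * x)

section PartialDerivatives

variable {θ : ℝ → ℝ → ℝ}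

theorem hasDerivAt_comp_pair
    (hθ : ContDiff ℝ (⊤ : ℕ∞) (fun p : ℝ × ℝ => θ p.1 p.2)) {a b : ℝ → ℝ} {a' b' s : ℝ}
    (ha : HasDerivAt a a' s) (hb : HasDerivAt b b' s) :
    HasDerivAt (fun r => θ (a r) (b r))
      (fderiv ℝ (fun p : ℝ × ℝ => θ p.1 p.2) (a s, b s) (a', b')) s := by
  have h := ((hθ.differentiable (by simp)) (a s, b s)).hasFDerivAt
  exact h.comp_hasDerivAt s (ha.prodMk hb)

theorem d1_eq_fderiv (hθ : ContDiff ℝ (⊤ : ℕ∞) (fun p : ℝ × ℝ => θ p.1 p.2)) (z1 z2 : ℝ) :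
    d1 θ z1 z2 = fderiv ℝ (fun p : ℝ × ℝ => θ p.1 p.2) (z1, z2) (1, 0) :=
  (hasDerivAt_comp_pair hθ (hasDerivAt_id z1) (hasDerivAt_const z1 z2)).deriv

theorem d2_eq_fderiv (hθ : ContDiff ℝ (⊤ : ℕ∞) (fun p : ℝ × ℝ => θ p.1 p.2)) (z1 z2 : ℝ) :
    d2 θ z1 z2 = fderiv ℝ (fun p : ℝ × ℝ => θ p.1 p.2) (z1, z2) (0, 1) :=
  (hasDerivAt_comp_pair hθ (hasDerivAt_const z2 z1) (hasDerivAt_id z2)).deriv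

/-- The chain rule in terms of the partial derivatives `d1` and `d2`. -/
theorem hasDerivAt_comp_d1_d2
    (hθ : ContDiff ℝ (⊤ : ℕ∞) (fun p : ℝ × ℝ => θ p.1 p.2)) {a b : ℝ → ℝ} {a' b' s : ℝ}
    (ha : HasDerivAt a a' s) (hb : HasDerivAt b b' s) :
    HasDerivAt (fun r => θ (a r) (b r)) (d1 θ (a s) (b s) * a' + d2 θ (a s) (b s) * b') s := by
  convert hasDerivAt_comp_pair hθ ha hb using 1
  have h : ((a', b') : ℝ × ℝ) = a' • (1, 0) + b' • (0, 1) := by simp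
  rw [h, map_add, map_smul, map_smul, d1_eq_fderiv hθ, d2_eq_fderiv hθ, smul_eq_mul, smul_eq_mul]
  ring

theorem contDiff_fderiv_apply
    (hθ : ContDiff ℝ (⊤ : ℕ∞) (fun p : ℝ × ℝ => θ p.1 p.2)) (v : ℝ × ℝ) :
    ContDiff ℝ (⊤ : ℕ∞) (fun p => fderiv ℝ (fun p : ℝ × ℝ => θ p.1 p.2) p v) :=
  (hθ.fderiv_right (by simp)).clm_apply contDiff_const

theorem contDiff_d1 (hθ : ContDiff ℝ (⊤ : ℕ∞) (fun p : ℝ × ℝ => θ p.1 p.2)) :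
    ContDiff ℝ (⊤ : ℕ∞) (fun p : ℝ × ℝ => d1 θ p.1 p.2) := by
  simpa only [d1_eq_fderiv hθ] using contDiff_fderiv_apply hθ (1, 0)

theorem contDiff_d2 (hθ : ContDiff ℝ (⊤ : ℕ∞) (fun p : ℝ × ℝ => θ p.1 p.2)) :
    ContDiff ℝ (⊤ : ℕ∞) (fun p : ℝ × ℝ => d2 θ p.1 p.2) := by
  simpa only [d2_eq_fderiv hθ] using contDiff_fderiv_apply hθ (0, 1)

/-- Equality of mixed partial derivatives. -/
theorem d1_d2_comm (hθ : ContDiff ℝ (⊤ : ℕ∞) (fun p : ℝ × ℝ => θ p.1 p.2)) (z1 z2 : ℝ) :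
    d1 (d2 θ) z1 z2 = d2 (d1 θ) z1 z2 := by
  have hd : DifferentiableAt ℝ (fderiv ℝ (fun p : ℝ × ℝ => θ p.1 p.2)) (z1, z2) :=
    ((hθ.fderiv_right (m := (⊤ : ℕ∞)) (by simp)).differentiable (by simp)) _
  have key (v w : ℝ × ℝ) :
      fderiv ℝ (fun p => fderiv ℝ (fun p : ℝ × ℝ => θ p.1 p.2) p v) (z1, z2) w
        = fderiv ℝ (fderiv ℝ (fun p : ℝ × ℝ => θ p.1 p.2)) (z1, z2) w v := by
    rw [fderiv_clm_apply hd (differentiableAt_const v)]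
    simp
  have hsymm : IsSymmSndFDerivAt ℝ (fun p : ℝ × ℝ => θ p.1 p.2) (z1, z2) :=
    hθ.contDiffAt.isSymmSndFDerivAt (by
      rw [minSmoothness_of_isRCLikeNormedField]
      exact WithTop.coe_le_coe.2 (le_top : (2 : ℕ∞) ≤ ⊤))
  rw [d1_eq_fderiv (contDiff_d2 hθ), d2_eq_fderiv (contDiff_d1 hθ)]
  simp only [d1_eq_fderiv hθ, d2_eq_fderiv hθ, Prod.mk.eta]
  rw [key, key, hsymm.eq]

/-- The `z₂`-derivative of a solution of the heat equation solves the heat equation. -/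
theorem d1_d2_eq_of_heat (hθ : ContDiff ℝ (⊤ : ℕ∞) (fun p : ℝ × ℝ => θ p.1 p.2))
    (hheat : ∀ z1 z2 : ℝ, d1 θ z1 z2 = d22 θ z1 z2) (z1 z2 : ℝ) :
    d1 (d2 θ) z1 z2 = d2 (d2 (d2 θ)) z1 z2 := by
  have h : d1 θ = d2 (d2 θ) := funext₂ hheat
  rw [d1_d2_comm hθ, h]

/-- Derivative in `t` along the reduction variables. -/
theorem hasDerivAt_reduction_t (hθ : ContDiff ℝ (⊤ : ℕ∞) (fun p : ℝ × ℝ => θ p.1 p.2))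
    (t x y : ℝ) :
    HasDerivAt (fun s => θ (s ^ 3 / 3) (y - s * x))
      (d1 θ (t ^ 3 / 3) (y - t * x) * t ^ 2 - d2 θ (t ^ 3 / 3) (y - t * x) * x) t := by
  have ha : HasDerivAt (fun s : ℝ => s ^ 3 / 3) (t ^ 2) t := by
    simpa using (hasDerivAt_pow 3 t).div_const 3
  have hb : HasDerivAt (fun s : ℝ => y - s * x) (-x) t := by
    simpa using ((hasDerivAt_id t).mul_const x).const_sub y
  convert hasDerivAt_comp_d1_d2 hθ ha hb using 1
  ring

/-- Derivative in `x` along the reduction variables. -/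
theorem hasDerivAt_reduction_x (hθ : ContDiff ℝ (⊤ : ℕ∞) (fun p : ℝ × ℝ => θ p.1 p.2))
    (t x y : ℝ) :
    HasDerivAt (fun s => θ (t ^ 3 / 3) (y - t * s)) (-t * d2 θ (t ^ 3 / 3) (y - t * x)) x := by
  have hb : HasDerivAt (fun s : ℝ => y - t * s) (-t) x := by
    simpa using ((hasDerivAt_id x).const_mul t).const_sub y
  convert hasDerivAt_comp_d1_d2 hθ (hasDerivAt_const x (t ^ 3 / 3)) hb using 1
  ring

/-- Derivative in `y` along the reduction variables. -/
theorem hasDerivAt_reduction_y (hθ : ContDiff ℝ (⊤ : ℕ∞) (fun p : ℝ × ℝ => θ p.1 p.2))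
    (t x y : ℝ) :
    HasDerivAt (fun s => θ (t ^ 3 / 3) (s - t * x)) (d2 θ (t ^ 3 / 3) (y - t * x)) y := by
  convert hasDerivAt_comp_d1_d2 hθ (hasDerivAt_const y (t ^ 3 / 3))
    ((hasDerivAt_id' y).sub_const (t * x)) using 1
  ring

theorem contDiff_reduction (hθ : ContDiff ℝ (⊤ : ℕ∞) (fun p : ℝ × ℝ => θ p.1 p.2)) :
    ContDiff ℝ (⊤ : ℕ∞)
      (fun p : ℝ × ℝ × ℝ => θ (p.1 ^ 3 / 3) (p.2.2 - p.1 * p.2.1)) := by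
  have h : ContDiff ℝ (⊤ : ℕ∞)
      (fun p : ℝ × ℝ × ℝ => ((p.1 ^ 3 / 3, p.2.2 - p.1 * p.2.1) : ℝ × ℝ)) := by
    fun_prop
  exact hθ.comp h

end PartialDerivatives

theorem contDiff_sol13 {θ1 θ0 : ℝ → ℝ → ℝ}
    (hθ1 : ContDiff ℝ (⊤ : ℕ∞) (fun p : ℝ × ℝ => θ1 p.1 p.2))
    (hθ0 : ContDiff ℝ (⊤ : ℕ∞) (fun p : ℝ × ℝ => θ0 p.1 p.2)) :
    ContDiff ℝ (⊤ : ℕ∞) (fun p : ℝ × ℝ × ℝ => sol13 θ1 θ0 p.1 p.2.1 p.2.2) := by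
  have hx : ContDiff ℝ (⊤ : ℕ∞) (fun p : ℝ × ℝ × ℝ => p.2.1) := by fun_prop
  have ht : ContDiff ℝ (⊤ : ℕ∞) (fun p : ℝ × ℝ × ℝ => p.1 ^ 2) := by fun_prop
  exact ((hx.mul (contDiff_reduction hθ1)).sub
    (ht.mul (contDiff_reduction (contDiff_d2 hθ1)))).add (contDiff_reduction hθ0)

theorem generalized_reduction_P1 (θ1 θ0 : ℝ → ℝ → ℝ)
    (hθ1 : ContDiff ℝ (⊤ : ℕ∞) (fun p : ℝ × ℝ => θ1 p.1 p.2))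
    (hθ0 : ContDiff ℝ (⊤ : ℕ∞) (fun p : ℝ × ℝ => θ0 p.1 p.2))
    (hheat1 : ∀ z1 z2 : ℝ, d1 θ1 z1 z2 = d22 θ1 z1 z2)
    (hheat0 : ∀ z1 z2 : ℝ, d1 θ0 z1 z2 = d22 θ0 z1 z2) :
    ContDiff ℝ 2 (fun p : ℝ × ℝ × ℝ => sol13 θ1 θ0 p.1 p.2.1 p.2.2) ∧
    ∀ t x y : ℝ,
      dT (sol13 θ1 θ0) t x y + x * dY (sol13 θ1 θ0) t x y
        = dXX (sol13 θ1 θ0) t x y := by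
  refine ⟨(contDiff_sol13 hθ1 hθ0).of_le (WithTop.coe_le_coe.2 (le_top : (2 : ℕ∞) ≤ ⊤)), fun t x y => ?_⟩
  have hd := contDiff_d2 hθ1
  have hdd := contDiff_d2 hd
  have hT := (((hasDerivAt_reduction_t hθ1 t x y).const_mul x).sub
    ((hasDerivAt_pow 2 t).mul (hasDerivAt_reduction_t hd t x y))).add
    (hasDerivAt_reduction_t hθ0 t x y)
  have hY := (((hasDerivAt_reduction_y hθ1 t x y).const_mul x).sub
    ((hasDerivAt_reduction_y hd t x y).const_mul (t ^ 2))).add (hasDerivAt_reduction_y hθ0 t x y)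
  have hX (r : ℝ) := (((hasDerivAt_id r).mul (hasDerivAt_reduction_x hθ1 t r y)).sub
    ((hasDerivAt_reduction_x hd t r y).const_mul (t ^ 2))).add (hasDerivAt_reduction_x hθ0 t r y)
  have hXX := (((hasDerivAt_reduction_x hθ1 t x y).const_mul 1).add
    ((hasDerivAt_id x).mul ((hasDerivAt_reduction_x hd t x y).const_mul (-t)))).sub
    (((hasDerivAt_reduction_x hdd t x y).const_mul (-t)).const_mul (t ^ 2)) |>.add
    ((hasDerivAt_reduction_x (contDiff_d2 hθ0) t x y).const_mul (-t))
  have eT : dT (sol13 θ1 θ0) t x y = _ := hT.deriv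
  have eY : dY (sol13 θ1 θ0) t x y = _ := hY.deriv
  have eX : deriv (fun s => sol13 θ1 θ0 t s y) = _ := funext fun r => (hX r).deriv
  have eXX : dXX (sol13 θ1 θ0) t x y = _ := (congrArg (deriv · x) eX).trans hXX.deriv
  have h1 : d1 θ1 = d2 (d2 θ1) := funext₂ hheat1
  have h0 : d1 θ0 = d2 (d2 θ0) := funext₂ hheat0
  rw [eT, eY, eXX, d1_d2_eq_of_heat hθ1 hheat1, h1, h0]
  simp only [id]
  push_cast
  ring
end

section
/- Let μ ≠ 0 and ν be real constants and set κ′ := (1/4)√(1 − 4μ) (so that (1/4) − κ′² = (μ + 3/4)/4 when 4μ ≤ 1; for 4μ > 1 interpret the hypothesis as φ'' (ω) + (−1/4 − ν/ω + (μ + 3/4)/(4ω²))φ(ω) = 0). Let φ : (0,∞) → ℝ be a C² function satisfying φ''(ω) + ( −1/4 − ν/ω + (μ + 3/4)/(4ω²) )·φ(ω) = 0 for all ω > 0. Then the function u(t,x) := t^{ν} · x^{−1/2} · exp( −x²/(8t) ) · φ( x²/(4t) ) is a solution of the (1+1)-dimensional linear heat equation with inverse square potential u_t = u_xx + μx^{−2}u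 on the open set {(t,x) ∈ ℝ² : t > 0, x > 0}. -/
/-- ∂_t u for u = u(t,x). -/
noncomputable def hT (u : ℝ → ℝ → ℝ) (t x : ℝ) : ℝ := deriv (fun s => u s x) t
/-- ∂²_x u for u = u(t,x). -/
noncomputable def hXX (u : ℝ → ℝ → ℝ) (t x : ℝ) : ℝ := deriv (deriv (fun s => u t s)) x

/-- The ansatz of the Lie reduction with respect to ⟨𝒟 + νℐ⟩ for t > 0. -/
noncomputable def sol19 (ν : ℝ) (φ : ℝ → ℝ) (t x : ℝ) : ℝ :=
  t ^ ν * x ^ (-(1 : ℝ) / 2) * Real.exp (-x ^ 2 / (8 * t)) * φ (x ^ 2 / (4 * t))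

lemma hasDerivAt_sol19_time {ν t x : ℝ} {φ : ℝ → ℝ} (ht : 0 < t)
    (hφ : DifferentiableAt ℝ φ (x ^ 2 / (4 * t))) :
    HasDerivAt (fun s => sol19 ν φ s x)
      (t ^ ν / t * x ^ (-(1 : ℝ) / 2) * Real.exp (-x ^ 2 / (8 * t)) *
        ((ν + x ^ 2 / (8 * t)) * φ (x ^ 2 / (4 * t))
          - x ^ 2 / (4 * t) * deriv φ (x ^ 2 / (4 * t)))) t := by
  have ht' : t ≠ 0 := ht.ne'
  have hpow : HasDerivAt (fun s : ℝ => s ^ ν) (ν * (t ^ ν / t)) t := by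
    simpa [Real.rpow_sub_one ht'] using Real.hasDerivAt_rpow_const (p := ν) (Or.inl ht')
  have hquot (c a : ℝ) (hc : c ≠ 0) :
      HasDerivAt (fun s : ℝ => a / (c * s)) (-(a / (c * t ^ 2))) t := by
    refine ((hasDerivAt_const t a).fun_div ((hasDerivAt_id' t).const_mul c)
      (mul_ne_zero hc ht')).congr_deriv ?_
    field_simp
    ring
  have hexp := (hquot 8 (-x ^ 2) (by norm_num)).exp
  have hcomp := hφ.hasDerivAt.comp t (hquot 4 (x ^ 2) (by norm_num))
  refine (((hpow.mul_const (x ^ (-(1 : ℝ) / 2))).fun_mul hexp).fun_mul hcomp).congr_deriv ?_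
  simp only [Function.comp_apply]
  field_simp
  ring

/-- The derivative in `x` of `t ^ ν * x ^ (-1 / 2) * exp (-x ^ 2 / (8 * t)) * h x`. -/
lemma hasDerivAt_heat_prefactor_mul {ν t x d : ℝ} {h : ℝ → ℝ} (ht : 0 < t) (hx : 0 < x)
    (hh : HasDerivAt h d x) :
    HasDerivAt (fun y => t ^ ν * y ^ (-(1 : ℝ) / 2) * Real.exp (-y ^ 2 / (8 * t)) * h y)
      (t ^ ν * x ^ (-(1 : ℝ) / 2) * Real.exp (-x ^ 2 / (8 * t)) *
        (d - (1 / (2 * x) + x / (4 * t)) * h x)) x := by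
  have ht' : t ≠ 0 := ht.ne'
  have hx' : x ≠ 0 := hx.ne'
  have hpow : HasDerivAt (fun y : ℝ => y ^ (-(1 : ℝ) / 2))
      (-(1 : ℝ) / 2 * (x ^ (-(1 : ℝ) / 2) / x)) x := by
    simpa only [Real.rpow_sub_one hx'] using
      Real.hasDerivAt_rpow_const (p := -(1 : ℝ) / 2) (Or.inl hx')
  have hexp := (((hasDerivAt_pow 2 x).fun_neg).div_const (8 * t)).exp
  refine (((hpow.const_mul (t ^ ν)).fun_mul hexp).fun_mul hh).congr_deriv ?_
  field_simp
  ring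

lemma hasDerivAt_comp_sq_div {t x : ℝ} {f : ℝ → ℝ} (ht : 0 < t)
    (hf : DifferentiableAt ℝ f (x ^ 2 / (4 * t))) :
    HasDerivAt (fun y => f (y ^ 2 / (4 * t)))
      (x / (2 * t) * deriv f (x ^ 2 / (4 * t))) x := by
  have ht' : t ≠ 0 := ht.ne'
  refine (hf.hasDerivAt.comp x ((hasDerivAt_pow 2 x).div_const (4 * t))).congr_deriv ?_
  field_simp
  ring

lemma contDiffOn_sol19 {ν : ℝ} {φ : ℝ → ℝ} {n : WithTop ℕ∞}
    (hφ : ContDiffOn ℝ n φ (Set.Ioi (0 : ℝ))) :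
    ContDiffOn ℝ n (fun p : ℝ × ℝ => sol19 ν φ p.1 p.2)
      {p : ℝ × ℝ | 0 < p.1 ∧ 0 < p.2} := by
  have hpos (c : ℝ) (hc : 0 < c) :
      ∀ p ∈ {p : ℝ × ℝ | 0 < p.1 ∧ 0 < p.2}, c * p.1 ≠ 0 :=
    fun p hp => (mul_pos hc hp.1).ne'
  refine ContDiffOn.mul (ContDiffOn.mul (ContDiffOn.mul ?_ ?_) ?_) ?_
  · exact contDiffOn_fst.rpow_const_of_ne fun p hp => hp.1.ne'
  · exact contDiffOn_snd.rpow_const_of_ne fun p hp => hp.2.ne'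
  · exact ((contDiffOn_snd.pow 2).neg.div (contDiffOn_const.mul contDiffOn_fst)
      (hpos 8 (by norm_num))).exp
  · refine hφ.comp ((contDiffOn_snd.pow 2).div (contDiffOn_const.mul contDiffOn_fst)
      (hpos 4 (by norm_num))) ?_
    rintro p ⟨h₁, h₂⟩
    exact Set.mem_Ioi.2 (by positivity)

lemma deriv_sol19_space {ν t x : ℝ} {φ : ℝ → ℝ} (ht : 0 < t) (hx : 0 < x)
    (hφ : DifferentiableAt ℝ φ (x ^ 2 / (4 * t))) :
    deriv (fun y => sol19 ν φ t y) x =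
      t ^ ν * x ^ (-(1 : ℝ) / 2) * Real.exp (-x ^ 2 / (8 * t)) *
        (x / (2 * t) * deriv φ (x ^ 2 / (4 * t))
          - (1 / (2 * x) + x / (4 * t)) * φ (x ^ 2 / (4 * t))) :=
  (hasDerivAt_heat_prefactor_mul ht hx (hasDerivAt_comp_sq_div ht hφ)).deriv

lemma hXX_sol19 {ν t x : ℝ} {φ : ℝ → ℝ} (ht : 0 < t) (hx : 0 < x)
    (hφ : ∀ ω : ℝ, 0 < ω → DifferentiableAt ℝ φ ω)
    (hφ' : DifferentiableAt ℝ (deriv φ) (x ^ 2 / (4 * t))) :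
    hXX (sol19 ν φ) t x =
      t ^ ν * x ^ (-(1 : ℝ) / 2) * Real.exp (-x ^ 2 / (8 * t)) *
        (x ^ 2 / (4 * t ^ 2) * (deriv (deriv φ) (x ^ 2 / (4 * t)) - deriv φ (x ^ 2 / (4 * t)))
          + (3 / (4 * x ^ 2) + x ^ 2 / (16 * t ^ 2)) * φ (x ^ 2 / (4 * t))) := by
  have ht' : t ≠ 0 := ht.ne'
  have hx' : x ≠ 0 := hx.ne'
  have hev : deriv (fun y => sol19 ν φ t y) =ᶠ[nhds x] fun y =>
      t ^ ν * y ^ (-(1 : ℝ) / 2) * Real.exp (-y ^ 2 / (8 * t)) *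
        (y / (2 * t) * deriv φ (y ^ 2 / (4 * t))
          - (1 / (2 * y) + y / (4 * t)) * φ (y ^ 2 / (4 * t))) := by
    filter_upwards [Ioi_mem_nhds hx] with y hy
    have hy : 0 < y := hy
    exact deriv_sol19_space ht hy (hφ _ (by positivity))
  have hinv : HasDerivAt (fun y : ℝ => 1 / (2 * y)) (-(1 / (2 * x ^ 2))) x := by
    refine ((hasDerivAt_const x (1 : ℝ)).fun_div ((hasDerivAt_id' x).const_mul 2)
      (mul_ne_zero two_ne_zero hx')).congr_deriv ?_
    field_simp
    ring
  have hbracket :=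
    (((hasDerivAt_id' x).div_const (2 * t)).fun_mul (hasDerivAt_comp_sq_div ht hφ')).fun_sub
      ((hinv.fun_add ((hasDerivAt_id' x).div_const (4 * t))).fun_mul
        (hasDerivAt_comp_sq_div ht (hφ _ (by positivity))))
  rw [hXX, hev.deriv_eq, (hasDerivAt_heat_prefactor_mul ht hx hbracket).deriv]
  field_simp
  ring

theorem lie_reduction_D_nu_I_heat_inverse_square_potential
    (μ ν : ℝ) (hμ : μ ≠ 0) (φ : ℝ → ℝ)
    (hφ : ContDiffOn ℝ 2 φ (Set.Ioi (0 : ℝ)))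
    (hwhit : ∀ ω : ℝ, 0 < ω →
      deriv (deriv φ) ω
        + (-(1 / 4) - ν / ω + (μ + 3 / 4) / (4 * ω ^ 2)) * φ ω = 0) :
    ContDiffOn ℝ 2 (fun p : ℝ × ℝ => sol19 ν φ p.1 p.2)
      {p : ℝ × ℝ | 0 < p.1 ∧ 0 < p.2} ∧
    ∀ t x : ℝ, 0 < t → 0 < x →
      hT (sol19 ν φ) t x
        = hXX (sol19 ν φ) t x + μ * x ^ (-(2 : ℤ)) * sol19 ν φ t x := by
  refine ⟨contDiffOn_sol19 hφ, fun t x ht hx => ?_⟩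
  have hdiff (ω : ℝ) (hω : 0 < ω) : DifferentiableAt ℝ φ ω :=
    (hφ.differentiableOn two_ne_zero).differentiableAt (Ioi_mem_nhds hω)
  have hdiff' (ω : ℝ) (hω : 0 < ω) : DifferentiableAt ℝ (deriv φ) ω :=
    (((contDiffOn_succ_iff_deriv_of_isOpen (n := 1) isOpen_Ioi).1 hφ).2.2.differentiableOn
      one_ne_zero).differentiableAt (Ioi_mem_nhds hω)
  have hω : 0 < x ^ 2 / (4 * t) := by positivity
  have hode : deriv (deriv φ) (x ^ 2 / (4 * t)) =
      (1 / 4 + 4 * ν * t / x ^ 2 - 4 * (μ + 3 / 4) * t ^ 2 / x ^ 4)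
        * φ (x ^ 2 / (4 * t)) := by
    rw [eq_neg_of_add_eq_zero_left (hwhit _ hω)]
    field_simp
    ring
  rw [hT, (hasDerivAt_sol19_time ht (hdiff _ hω)).deriv,
    hXX_sol19 ht hx hdiff (hdiff' _ hω), hode, sol19, zpow_neg]
  norm_cast
  field_simp
  ring
end
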